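/- Let w be a weight function on the goods [m], let n ≥ 1, and let μ be the maximin share. Then there exists an n-partition A = (A_1,...,A_n) of [m] with w(A_i) ≥ μ/2 for every i, such that for every sequence of real valuation parameters v_1 ≥ v_2 ≥ ... ≥ v_n ≥ 0 and every n-partition O = (O_1,...,O_n) of [m] with w(O_1) ≥ w(O_2) ≥ ... ≥ w(O_n), with w(O_i) ≥ μ for all i, and maximizing Σ_{i=1}^n v_i · w(S_i) over all n-partitions (S_1,...,S_n) satisfying w(S_i) ≥ μ for all i, the sequence (w(A_1),...,w(A_n)) majorizes (w(O_1),...,w(O_n)): for every 1 ≤ k ≤ n−1 the sum of the k largest values among w(A_1),...,w(A_n) is at least Σ_{i=1}^k w(O_i), and the total sums are equal. -/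

import Mathlib

open Finset

/-- Weight of a bundle: sum of the weights of its goods. -/
noncomputable def setW {m : ℕ} (w : Fin m → ℝ) (S : Finset (Fin m)) : ℝ := ∑ g ∈ S, w g

/-- An `n`-partition of the goods `[m]`: pairwise disjoint parts covering everything. -/
def IsPartition {m n : ℕ} (P : Fin n → Finset (Fin m)) : Prop :=
  (∀ i j, i ≠ j → Disjoint (P i) (P j)) ∧ Finset.univ.biUnion P = Finset.univ

/-- `μ` is the maximin share. -/
def IsMaximinShare {m n : ℕ} (w : Fin m → ℝ) (μ : ℝ) : Prop :=
  (∃ P : Fin n → Finset (Fin m), IsPartition P ∧ ∀ j, μ ≤ setW w (P j)) ∧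
  (∀ P : Fin n → Finset (Fin m), IsPartition P → ∃ j, setW w (P j) ≤ μ)

section MaximinMajorization

variable {m n : ℕ} {w : Fin m → ℝ} {μ : ℝ}

theorem setW_nonneg (hw : ∀ g, 0 ≤ w g) (S : Finset (Fin m)) : 0 ≤ setW w S :=
  sum_nonneg fun g _ => hw g

theorem setW_mono (hw : ∀ g, 0 ≤ w g) {S T : Finset (Fin m)} (h : S ⊆ T) :
    setW w S ≤ setW w T :=
  sum_le_sum_of_subset_of_nonneg h fun g _ _ => hw g

theorem IsPartition.sum_setW {P : Fin n → Finset (Fin m)} (hP : IsPartition P)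
    (w : Fin m → ℝ) : ∑ i, setW w (P i) = setW w univ := by
  unfold setW
  rw [← hP.2, sum_biUnion fun i _ j _ h => hP.1 i j h]

/-- If values on `F` lie below a threshold and values off `F` above it, then `F` has the smallest sum
among sets of its size. -/
theorem sum_le_sum_of_threshold {ι : Type*} [DecidableEq ι] {f : ι → ℝ} {F U : Finset ι} (c : ℝ)
    (hF : ∀ i ∈ F, f i ≤ c) (hU : ∀ i ∉ F, c ≤ f i) (hcard : F.card = U.card) :
    ∑ i ∈ F, f i ≤ ∑ i ∈ U, f i := by
  have h1 : ∑ i ∈ F, (f i - c) ≤ ∑ i ∈ F ∩ U, (f i - c) := by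
    rw [← sum_inter_add_sum_sdiff F U]
    have : ∑ i ∈ F \ U, (f i - c) ≤ 0 :=
      sum_nonpos fun i hi => sub_nonpos.2 (hF i (mem_sdiff.1 hi).1)
    linarith
  have h2 : ∑ i ∈ F ∩ U, (f i - c) ≤ ∑ i ∈ U, (f i - c) := by
    rw [← sum_inter_add_sum_sdiff U F, inter_comm F U]
    have : 0 ≤ ∑ i ∈ U \ F, (f i - c) :=
      sum_nonneg fun i hi => sub_nonneg.2 (hU i (mem_sdiff.1 hi).2)
    linarith
  have h3 := h1.trans h2
  simp only [sum_sub_distrib, sum_const, nsmul_eq_mul, hcard] at h3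
  linarith

/-- The first `k` terms of a nonincreasing sequence have the largest sum among `k` terms. -/
theorem Antitone.sum_le_sum_filter_lt {f : Fin n → ℝ} (hf : Antitone f) {k : ℕ} (hk : 1 ≤ k)
    (hkn : k ≤ n) {U : Finset (Fin n)} (hU : U.card = k) :
    ∑ i ∈ U, f i ≤ ∑ i ∈ univ.filter (fun i : Fin n => (i : ℕ) < k), f i := by
  have hcard : (univ.filter (fun i : Fin n => (i : ℕ) < k)).card = U.card := by
    rw [Fin.card_filter_val_lt, hU, min_eq_right hkn]
  have := sum_le_sum_of_threshold (f := fun i => -f i) (U := U)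
    (F := univ.filter (fun i : Fin n => (i : ℕ) < k)) (-f ⟨k - 1, by omega⟩)
    (fun i hi => neg_le_neg (hf (Fin.le_def.2 (by simp at hi ⊢; omega))))
    (fun i hi => neg_le_neg (hf (Fin.le_def.2 (by simp at hi ⊢; omega)))) hcard
  simp only [sum_neg_distrib] at this
  linarith

/-- A set of goods of weight at most `μ` with total weight at least `μ` contains a bundle of weight
between `μ / 2` and `μ`. -/
theorem exists_subset_setW_mem (hμ : 0 ≤ μ) {T : Finset (Fin m)} (hT : ∀ g ∈ T, w g ≤ μ)
    (hTW : μ ≤ setW w T) : ∃ S ⊆ T, μ / 2 ≤ setW w S ∧ setW w S ≤ μ := by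
  obtain ⟨S, hS, hmin⟩ := (T.powerset.filter fun S => μ / 2 ≤ setW w S).exists_min_image card
    ⟨T, by simp; linarith⟩
  simp only [mem_filter, mem_powerset] at hS hmin
  refine ⟨S, hS.1, hS.2, ?_⟩
  by_contra! hlt
  obtain ⟨g, hg⟩ : S.Nonempty := by
    rw [nonempty_iff_ne_empty]
    rintro rfl
    simp [setW] at hlt
    linarith
  have hsum : w g + setW w (S.erase g) = setW w S := add_sum_erase S w hg
  by_cases h : μ / 2 ≤ setW w (S.erase g)
  · have := hmin _ ⟨(erase_subset g S).trans hS.1, h⟩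
    have := card_erase_lt_of_mem hg
    omega
  · have h1 := hmin {g} ⟨singleton_subset_iff.2 (hS.1 hg), by simp [setW]; linarith⟩
    rw [card_singleton, card_le_one] at h1
    have h2 : S.erase g = ∅ := eq_empty_of_forall_notMem fun y hy =>
      ne_of_mem_erase hy (h1 y (mem_of_mem_erase hy) g hg)
    rw [h2] at hsum
    have := hT g (hS.1 hg)
    simp [setW] at hsum hlt
    linarith

/-- Bag filling: goods of weight at most `μ` and total weight at least `s * μ` contain `s` disjoint
bundles of weight between `μ / 2` and `μ`. -/
theorem exists_disjoint_bundles (hμ : 0 ≤ μ) (s : ℕ) (T : Finset (Fin m))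
    (hT : ∀ g ∈ T, w g ≤ μ) (hTW : s * μ ≤ setW w T) :
    ∃ B : ℕ → Finset (Fin m), (∀ i < s, B i ⊆ T ∧ μ / 2 ≤ setW w (B i) ∧ setW w (B i) ≤ μ) ∧
      ∀ i < s, ∀ j < i, Disjoint (B i) (B j) := by
  induction s generalizing T with
  | zero => exact ⟨fun _ => ∅, by simp, by simp⟩
  | succ s ih =>
    push_cast at hTW
    have hsμ : 0 ≤ s * μ := by positivity
    obtain ⟨S, hST, hS1, hS2⟩ := exists_subset_setW_mem hμ hT (by linarith)
    have hsum : setW w (T \ S) + setW w S = setW w T := sum_sdiff hST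
    obtain ⟨B, hB, hdisj⟩ := ih (T \ S) (fun g hg => hT g (mem_sdiff.1 hg).1) (by linarith)
    refine ⟨Function.update B s S, fun i hi => ?_, fun i hi j hj => ?_⟩
    · rcases eq_or_ne i s with rfl | h
      · simpa using ⟨hST, hS1, hS2⟩
      · rw [Function.update_of_ne h]
        obtain ⟨h1, h2⟩ := hB i (by omega)
        exact ⟨h1.trans sdiff_subset, h2⟩
    · rw [Function.update_of_ne (show j ≠ s by omega)]
      rcases eq_or_ne i s with rfl | h
      · rw [Function.update_self]
        exact (disjoint_of_subset_left (hB j hj).1 sdiff_disjoint).symm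
      · rw [Function.update_of_ne h]
        exact hdisj i (by omega) j hj

/-- The goods of `S` listed as singletons by increasing weight: each initial sum is at most the
weight of any subset of `S` of the same size. -/
theorem exists_sorted_singletons (w : Fin m → ℝ) (S : Finset (Fin m)) :
    ∃ D : ℕ → Finset (Fin m), (∀ i < S.card, D i ⊆ S ∧ (D i).Nonempty) ∧
      (∀ i < S.card, ∀ j < i, Disjoint (D i) (D j)) ∧
      ∀ U ⊆ S, ∑ i ∈ range U.card, setW w (D i) ≤ setW w U := by
  classical
  induction S using Finset.induction_on_max_value w with
  | empty =>
    refine ⟨fun _ => ∅, by simp, by simp, fun U hU => ?_⟩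
    simp [subset_empty.1 hU, setW]
  | insert a S ha hmax ih =>
    obtain ⟨D, hD, hdisj, hle⟩ := ih
    rw [card_insert_of_notMem ha]
    have hcongr : ∀ t ≤ S.card, ∑ i ∈ range t, setW w (Function.update D S.card {a} i) =
        ∑ i ∈ range t, setW w (D i) := fun t ht => sum_congr rfl fun i hi => by
      rw [Function.update_of_ne (by have := mem_range.1 hi; omega)]
    refine ⟨Function.update D S.card {a}, fun i hi => ?_, fun i hi j hj => ?_, fun U hU => ?_⟩
    · rcases eq_or_ne i S.card with rfl | h
      · simp
      · rw [Function.update_of_ne h]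
        obtain ⟨h1, h2⟩ := hD i (by omega)
        exact ⟨h1.trans (subset_insert _ _), h2⟩
    · rw [Function.update_of_ne (show j ≠ S.card by omega)]
      rcases eq_or_ne i S.card with rfl | h
      · rw [Function.update_self, disjoint_singleton_left]
        exact fun h => ha ((hD j hj).1 h)
      · rw [Function.update_of_ne h]
        exact hdisj i (by omega) j hj
    · by_cases haU : a ∈ U
      · have hsum : w a + setW w (U.erase a) = setW w U := add_sum_erase U w haU
        have hUS : U.erase a ⊆ S := fun x hx => by
          have := hU (mem_of_mem_erase hx)
          exact (mem_insert.1 this).resolve_left (ne_of_mem_erase hx)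
        by_cases hx : ∃ x ∈ S, x ∉ U.erase a
        · obtain ⟨x, hxS, hxU⟩ := hx
          have hcard : (insert x (U.erase a)).card = U.card := by
            rw [card_insert_of_notMem hxU, card_erase_add_one haU]
          have hsub : insert x (U.erase a) ⊆ S := insert_subset hxS hUS
          have h1 := hle _ hsub
          have h2 : setW w (insert x (U.erase a)) = w x + setW w (U.erase a) := sum_insert hxU
          have h3 := hmax x hxS
          rw [hcard] at h1
          rw [hcongr _ (hcard ▸ card_le_card hsub)]
          linarith
        · push Not at hx
          have hUS' : U.erase a = S := hUS.antisymm hx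
          have h1 := hle S subset_rfl
          have hcard : U.card = S.card + 1 := by rw [← hUS', card_erase_add_one haU]
          rw [hcard, sum_range_succ, hcongr _ le_rfl, Function.update_self, ← hsum, hUS']
          have : setW w {a} = w a := sum_singleton _ _
          linarith
      · have hUS : U ⊆ S := fun x hx =>
          (mem_insert.1 (hU hx)).resolve_left fun h => haU (h ▸ hx)
        rw [hcongr _ (card_le_card hUS)]
        exact hle U hUS

/-- Disjoint bundles extended to a partition by a last part consisting of all remaining goods. -/
theorem exists_partition_extending (hn : 1 ≤ n) {C : ℕ → Finset (Fin m)}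
    (hC : ∀ i < n - 1, ∀ j < i, Disjoint (C i) (C j)) :
    ∃ A : Fin n → Finset (Fin m), IsPartition A ∧ (∀ i : Fin n, (i : ℕ) < n - 1 → A i = C i) ∧
      ∀ i : Fin n, ¬ (i : ℕ) < n - 1 → A i = univ \ (range (n - 1)).biUnion C := by
  refine ⟨fun i => if (i : ℕ) < n - 1 then C i else univ \ (range (n - 1)).biUnion C,
    ⟨fun i j hij => ?_, ?_⟩, fun i hi => if_pos hi, fun i hi => if_neg hi⟩
  · have hij' : (i : ℕ) ≠ j := fun h => hij (Fin.ext h)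
    have key : ∀ k < n - 1, Disjoint (C k) (univ \ (range (n - 1)).biUnion C) := fun k hk =>
      disjoint_of_subset_left (subset_biUnion_of_mem C (mem_range.2 hk)) disjoint_sdiff
    dsimp only
    split_ifs with hi hj hj
    · rcases lt_or_gt_of_ne hij' with h | h
      · exact (hC _ hj _ h).symm
      · exact hC _ hi _ h
    · exact key _ hi
    · exact (key _ hj).symm
    · omega
  · refine eq_univ_of_forall fun g => mem_biUnion.2 ?_
    by_cases hg : g ∈ (range (n - 1)).biUnion C
    · obtain ⟨k, hk, hgk⟩ := mem_biUnion.1 hg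
      have hk := mem_range.1 hk
      exact ⟨⟨k, by omega⟩, mem_univ _, by simpa [hk] using hgk⟩
    · exact ⟨⟨n - 1, by omega⟩, mem_univ _, by simpa using hg⟩

theorem IsPartition.card_mul_le_setW {P : Fin n → Finset (Fin m)} (hP : IsPartition P)
    (hw : ∀ g, 0 ≤ w g) (hPμ : ∀ i, μ ≤ setW w (P i)) {S : Finset (Fin m)}
    {Z : Finset (Fin n)} (hZ : ∀ i ∈ Z, P i ⊆ S) : Z.card * μ ≤ setW w S := by
  have h1 : ∑ i ∈ Z, setW w (P i) = setW w (Z.biUnion P) :=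
    (sum_biUnion fun i _ j _ h => hP.1 i j h).symm
  have h2 : setW w (Z.biUnion P) ≤ setW w S := setW_mono hw (biUnion_subset.2 hZ)
  have h3 := card_nsmul_le_sum Z (fun i => setW w (P i)) μ fun i _ => hPμ i
  rw [nsmul_eq_mul] at h3
  linarith

/-- Parts of a partition meeting a set `S` admit distinct representatives in `S`. -/
theorem IsPartition.exists_representatives {P : Fin n → Finset (Fin m)} (hP : IsPartition P)
    (hw : ∀ g, 0 ≤ w g) {S : Finset (Fin m)} {U : Finset (Fin n)}
    (hU : ∀ i ∈ U, ∃ g ∈ P i, g ∈ S) :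
    ∃ G ⊆ S, G.card = U.card ∧ setW w G ≤ ∑ i ∈ U, setW w (P i) := by
  rcases U.eq_empty_or_nonempty with rfl | ⟨i, hi⟩
  · exact ⟨∅, by simp [setW]⟩
  have : Nonempty (Fin m) := (hU i hi).nonempty
  choose! r hrP hrS using hU
  have hinj : Set.InjOn r U := fun i hi j hj h => by
    by_contra hij
    exact disjoint_left.1 (hP.1 i j hij) (hrP i hi) (h ▸ hrP j hj)
  refine ⟨U.image r, image_subset_iff.2 hrS, card_image_of_injOn hinj, ?_⟩
  unfold setW
  rw [sum_image hinj]
  exact sum_le_sum fun i hi => single_le_sum (f := w) (fun g _ => hw g) (hrP i hi)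

/-- There is a partition into parts of weight at least `μ / 2` in which the first `j < n` parts
weigh in total no more than any `j` parts of any partition into parts of weight at least `μ`. -/
theorem exists_half_partition_dominating (hn : 1 ≤ n) (hw : ∀ g, 0 ≤ w g) (hμ : 0 ≤ μ)
    {P : Fin n → Finset (Fin m)} (hP : IsPartition P) (hPμ : ∀ i, μ ≤ setW w (P i)) :
    ∃ A : Fin n → Finset (Fin m), IsPartition A ∧ (∀ i, μ / 2 ≤ setW w (A i)) ∧
      ∀ O : Fin n → Finset (Fin m), IsPartition O → (∀ i, μ ≤ setW w (O i)) →
        ∀ T : Finset (Fin n), T.card ≤ n - 1 →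
          ∑ i ∈ univ.filter (fun i : Fin n => (i : ℕ) < T.card), setW w (A i) ≤
            ∑ i ∈ T, setW w (O i) := by
  classical
  set small : Finset (Fin m) := univ.filter fun g => w g ≤ μ with hsmall
  set big : Finset (Fin m) := univ.filter fun g => ¬ w g ≤ μ with hbig
  set s := Nat.findGreatest (fun s : ℕ => s * μ ≤ setW w small) (n - 1)
  have hsn : s ≤ n - 1 := Nat.findGreatest_le _
  have hsW : s * μ ≤ setW w small :=
    Nat.findGreatest_spec (P := fun s : ℕ => s * μ ≤ setW w small) (Nat.zero_le _)
      (by simpa using setW_nonneg hw small)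
  have hsmax : ∀ q : ℕ, q ≤ n - 1 → q * μ ≤ setW w small → q ≤ s := fun q h1 h2 =>
    Nat.le_findGreatest h1 h2
  have hZ : ∀ O : Fin n → Finset (Fin m), IsPartition O → (∀ i, μ ≤ setW w (O i)) →
      big.Nonempty → (univ.filter fun i => ¬ ∃ g ∈ O i, g ∈ big).card ≤ s := by
    rintro O hO hOμ ⟨g, hg⟩
    refine hsmax _ ?_ (hO.card_mul_le_setW hw hOμ fun i hi g hg => ?_)
    · obtain ⟨i, -, hi⟩ := mem_biUnion.1 (hO.2 ▸ mem_univ g)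
      have : (univ.filter fun i => ¬ ∃ g ∈ O i, g ∈ big) ⊂ univ :=
        ssubset_univ_iff.2 fun h => by
          have hmem := h.symm ▸ mem_univ i
          exact (mem_filter.1 hmem).2 ⟨g, hi, hg⟩
      have := card_lt_card this
      rw [card_univ, Fintype.card_fin] at this
      omega
    · by_contra hgs
      exact (mem_filter.1 hi).2 ⟨g, hg, by simpa [hsmall, hbig] using hgs⟩
  have hL : big.Nonempty → n - 1 - s < big.card := fun hne => by
    obtain ⟨G, hGS, hGc, -⟩ := hP.exists_representatives hw (S := big)
      (U := univ.filter fun i => ∃ g ∈ P i, g ∈ big) fun i hi => (mem_filter.1 hi).2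
    have h1 := hZ P hP hPμ hne
    have h2 := card_filter_add_card_filter_not (s := (univ : Finset (Fin n)))
      (fun i => ∃ g ∈ P i, g ∈ big)
    have h3 := card_le_card hGS
    rw [card_univ, Fintype.card_fin] at h2
    omega
  have htotal : n * μ ≤ setW w univ := by
    simpa using hP.card_mul_le_setW hw hPμ (S := univ) (Z := univ) fun i _ => subset_univ _
  have hs_empty : ¬ big.Nonempty → s = n - 1 := fun hne => by
    refine hsn.antisymm (hsmax _ le_rfl ?_)
    have : small = univ := by
      refine eq_univ_of_forall fun g => ?_
      by_contra hgs
      exact hne ⟨g, by simpa [hsmall, hbig] using hgs⟩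
    rw [this]
    have : ((n - 1 : ℕ) : ℝ) ≤ n := by exact_mod_cast Nat.sub_le _ _
    nlinarith
  have hsb : Disjoint small big := disjoint_filter_filter_not _ _ _
  obtain ⟨B, hB, hBd⟩ := exists_disjoint_bundles (w := w) hμ s small
    (fun g hg => (mem_filter.1 hg).2) hsW
  obtain ⟨D, hD, hDd, hDle⟩ := exists_sorted_singletons w big
  have hDμ : ∀ i < big.card, μ ≤ setW w (D i) := fun i hi => by
    obtain ⟨h1, g, hg⟩ := hD i hi
    have h2 : w g ≤ setW w (D i) := single_le_sum (f := w) (fun g _ => hw g) hg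
    have := (mem_filter.1 (h1 hg)).2
    linarith
  set C : ℕ → Finset (Fin m) := fun i => if i < s then B i else D (i - s) with hCdef
  have hCB : ∀ i < s, C i = B i := fun i hi => if_pos hi
  have hCD : ∀ i, C (s + i) = D i := fun i => by simp [hCdef]
  have hCd : ∀ i < s + big.card, ∀ j < i, Disjoint (C i) (C j) := fun i hi j hj => by
    by_cases h1 : i < s
    · rw [hCB i h1, hCB j (hj.trans h1)]
      exact hBd i h1 j hj
    · obtain ⟨i, rfl⟩ := Nat.exists_eq_add_of_le (not_lt.1 h1)
      rw [hCD]
      by_cases h2 : j < s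
      · rw [hCB j h2]
        exact disjoint_of_subset_left (hD i (by omega)).1
          (disjoint_of_subset_right (hB j h2).1 hsb.symm)
      · obtain ⟨j, rfl⟩ := Nat.exists_eq_add_of_le (not_lt.1 h2)
        rw [hCD]
        exact hDd i (by omega) j (by omega)
  have hn1 : n - 1 ≤ s + big.card := by
    by_cases hne : big.Nonempty
    · have := hL hne
      omega
    · have := hs_empty hne
      omega
  obtain ⟨A, hA, hAC, hAlast⟩ := exists_partition_extending hn
    (fun i hi => hCd i (lt_of_lt_of_le hi hn1))
  have hCsum : ∀ j ≤ n - 1,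
      ∑ i ∈ univ.filter (fun i : Fin n => (i : ℕ) < j), setW w (A i) =
        ∑ i ∈ range j, setW w (C i) := fun j hj => by
    refine sum_bij (fun i _ => (i : ℕ)) (fun i hi => by simpa using hi)
      (fun i _ k _ h => Fin.ext h)
      (fun k hk => ⟨⟨k, by have := mem_range.1 hk; omega⟩, by simpa using hk, rfl⟩)
      (fun i hi => by rw [hAC i (by have := (mem_filter.1 hi).2; omega)])
  have hBsum : ∀ j ≤ s, ∑ i ∈ range j, setW w (C i) ≤ j * μ := fun j hj => by
    have := sum_le_card_nsmul (range j) (fun i => setW w (C i)) μ fun i hi => by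
      have hi : i < s := (mem_range.1 hi).trans_le hj
      rw [hCB i hi]
      exact (hB i hi).2.2
    simpa using this
  refine ⟨A, hA, fun i => ?_, fun O hO hOμ T hT => ?_⟩
  · by_cases hi : (i : ℕ) < n - 1
    · rw [hAC i hi]
      by_cases h1 : (i : ℕ) < s
      · rw [hCB _ h1]
        exact (hB _ h1).2.1
      · obtain ⟨k, hk⟩ := Nat.exists_eq_add_of_le (not_lt.1 h1)
        rw [hk, hCD]
        have := hDμ k (by omega)
        linarith
    · rw [hAlast i hi]
      by_cases hne : big.Nonempty
      · have hlt := hL hne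
        have h1 := hDμ _ hlt
        have h2 : D (n - 1 - s) ⊆ univ \ (range (n - 1)).biUnion C := by
          refine subset_sdiff.2 ⟨subset_univ _, (disjoint_biUnion_right _ _ _).2 fun j hj => ?_⟩
          rw [← hCD]
          have := mem_range.1 hj
          exact hCd _ (by omega) j (by omega)
        have := setW_mono hw h2
        linarith
      · have hse := hs_empty hne
        have h1 : setW w (univ \ (range (n - 1)).biUnion C) +
            setW w ((range (n - 1)).biUnion C) = setW w univ := sum_sdiff (subset_univ _)
        have h2 : setW w ((range (n - 1)).biUnion C) = ∑ i ∈ range (n - 1), setW w (C i) := by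
          refine sum_biUnion fun i hi j hj hij => ?_
          have hi : i < n - 1 := by simpa using hi
          have hj : j < n - 1 := by simpa using hj
          rcases lt_or_gt_of_ne hij with h | h
          · exact (hCd j (by omega) i h).symm
          · exact hCd i (by omega) j h
        have h3 := hBsum (n - 1) hse.ge
        have h4 : ((n - 1 : ℕ) : ℝ) = n - 1 := by simp [Nat.cast_sub hn]
        rw [h4] at h3
        linarith
  · rw [hCsum _ hT]
    have hcardμ : ∀ V : Finset (Fin n), V.card * μ ≤ ∑ i ∈ V, setW w (O i) := fun V => by
      simpa using card_nsmul_le_sum V (fun i => setW w (O i)) μ fun i _ => hOμ i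
    by_cases hjs : T.card ≤ s
    · exact (hBsum _ hjs).trans (hcardμ T)
    · have hne : big.Nonempty := by
        by_contra hne
        have := hs_empty hne
        omega
      have h1 := (card_le_card (filter_subset_filter (fun i => ¬ ∃ g ∈ O i, g ∈ big)
        (subset_univ T))).trans (hZ O hO hOμ hne)
      have h2 := card_filter_add_card_filter_not (s := T) (fun i => ∃ g ∈ O i, g ∈ big)
      obtain ⟨U, hUT, hUc⟩ := exists_subset_card_eq
        (show T.card - s ≤ (T.filter fun i => ∃ g ∈ O i, g ∈ big).card by omega)
      obtain ⟨G, hGS, hGc, hGle⟩ := hO.exists_representatives hw (S := big) (U := U)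
        fun i hi => (mem_filter.1 (hUT hi)).2
      have hUT' : U ⊆ T := hUT.trans (filter_subset _ _)
      have hsplit : T.card = s + G.card := by omega
      have h3 := hDle G hGS
      have h4 := hcardμ (T \ U)
      have h5 : (T \ U).card = s := by
        rw [card_sdiff_of_subset hUT']
        omega
      have h6 := hBsum s le_rfl
      have h7 := sum_sdiff (f := fun i => setW w (O i)) hUT'
      rw [h5] at h4
      rw [hsplit, sum_range_add]
      simp only [hCD]
      linarith

end MaximinMajorization

/-- there is a `1/2`-approximately MMS partition `A` such that, for every
nonincreasing nonnegative valuation profile `v` and every sorted MMS-feasible partition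
`O` maximizing the social welfare among MMS-feasible partitions, the weight sequence of
`A` majorizes that of `O`. -/
theorem stmt5 {m n : ℕ} (hn : 1 ≤ n) (w : Fin m → ℝ) (hw : ∀ g, 0 ≤ w g)
    (μ : ℝ) (hμ : IsMaximinShare (n := n) w μ) :
    ∃ A : Fin n → Finset (Fin m), IsPartition A ∧
      (∀ i, setW w (A i) ≥ μ / 2) ∧
      ∀ v : Fin n → ℝ, Antitone v → (∀ i, 0 ≤ v i) →
        ∀ O : Fin n → Finset (Fin m), IsPartition O →
          Antitone (fun i => setW w (O i)) → (∀ i, setW w (O i) ≥ μ) →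
          (∀ S : Fin n → Finset (Fin m), IsPartition S → (∀ i, setW w (S i) ≥ μ) →
            ∑ i, v i * setW w (S i) ≤ ∑ i, v i * setW w (O i)) →
          (∀ σ : Equiv.Perm (Fin n), Antitone (fun i => setW w (A (σ i))) →
            ∀ k : ℕ, 1 ≤ k → k ≤ n - 1 →
              ∑ i ∈ Finset.univ.filter (fun i : Fin n => (i : ℕ) < k), setW w (A (σ i)) ≥
                ∑ i ∈ Finset.univ.filter (fun i : Fin n => (i : ℕ) < k), setW w (O i)) ∧
          ∑ i, setW w (A i) = ∑ i, setW w (O i) := by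
  obtain ⟨⟨P, hP, hPμ⟩, hmax⟩ := hμ
  have hμ0 : 0 ≤ μ := by
    obtain ⟨j, hj⟩ := hmax P hP
    exact (setW_nonneg hw _).trans hj
  obtain ⟨A, hA, hAμ, hAO⟩ := exists_half_partition_dominating hn hw hμ0 hP hPμ
  refine ⟨A, hA, hAμ, fun v _ _ O hO _ hOμ _ => ⟨fun σ hσ k hk hkn => ?_, ?_⟩⟩
  · have hcompl : ∀ f : Fin n → ℝ, ∀ j : ℕ,
        ∑ i ∈ univ.filter (fun i : Fin n => (i : ℕ) < j), f i +
          ∑ i ∈ univ.filter (fun i : Fin n => ¬ (i : ℕ) < j), f i = ∑ i, f i := fun f j =>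
      sum_filter_add_sum_filter_not _ _ _
    have hcard : ∀ j ≤ n, (univ.filter (fun i : Fin n => ¬ (i : ℕ) < j)).card = n - j :=
      fun j hj => by
        have h := card_filter_add_card_filter_not (s := (univ : Finset (Fin n)))
          (fun i => (i : ℕ) < j)
        rw [Fin.card_filter_val_lt, card_univ, Fintype.card_fin] at h
        omega
    have hT := hcard k (by omega)
    have h1 := hAO O hO hOμ (univ.filter fun i : Fin n => ¬ (i : ℕ) < k) (by omega)
    rw [hT] at h1
    have h2 := hσ.sum_le_sum_filter_lt hk (by omega)
      (U := (univ.filter fun i : Fin n => ¬ (i : ℕ) < n - k).map σ.symm.toEmbedding)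
      (by rw [card_map, hcard _ (Nat.sub_le n k)]; omega)
    simp only [sum_map, Equiv.coe_toEmbedding, Equiv.apply_symm_apply] at h2
    have h3 := hcompl (fun i => setW w (A i)) (n - k)
    have h4 := hcompl (fun i => setW w (O i)) k
    have h5 := (hA.sum_setW w).trans (hO.sum_setW w).symm
    linarith
  · exact (hA.sum_setW w).trans (hO.sum_setW w).symm
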